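/- For every decomposable SPN S over a finite set of variables with finite nonempty domains there exists a valid SPGM S'' over the same variables such that for every partial assignment y, the SPGM evaluation S''(y) by message passing equals the SPN evaluation S(y). Hence SPGMs are at least as expressive as SPNs, and together with the converse encoding of SPGMs as SPNs, the two classes represent exactly the same evaluation functions. -/

import Mathlib

attribute [local instance] Classical.propDecidable

noncomputable section

/-- Indicator variable `[v]_k` relative to a partial assignment `y`
(`y v = none` means `v` is unobserved). -/
def Indicator {Var : Type} (y : Var → Option ℕ) (v : Var) (k : ℕ) : ℝ :=
  match y v with
  | none => 1
  | some i => if i = k then 1 else 0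

/-- Kinds of nodes of a sum-product graphical model: variable nodes (Vnodes),
product nodes, observed sum nodes and unobserved sum nodes. -/
inductive SPGMKind (Xvar Zvar : Type) : Type where
  | vnode (x : Xvar)
  | prod
  | sumObs (z : Zvar)
  | sumUnobs

/-- A sum-product graphical model (SPGM) over variables `Xvar` (with domain sizes `Xdom`)
and context variables `Zvar` (with domain sizes `Zdom`).  The underlying directed graph
is given by `children`; acyclicity is encoded by the strictly decreasing `rank`.
`Q`/`W` are the edge weights of observed/unobserved sum nodes (`Q t k` is the weight of the
`k`-th child edge of `t`), `Pcond t s k j` is the conditional table `P_{s,t}(k | j)` used when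
`s` is a Vparent of the Vnode `t`, and `Punary t k` is the unary table `P_t(k)` used when the
Vnode `t` has no Vparent. -/
structure SPGM (Xvar Zvar : Type) (Xdom : Xvar → ℕ) (Zdom : Zvar → ℕ) where
  V : Type
  fintypeV : Fintype V
  decEqV : DecidableEq V
  root : V
  kind : V → SPGMKind Xvar Zvar
  children : V → List V
  rank : V → ℕ
  rank_lt : ∀ t c, c ∈ children t → rank c < rank t
  Q : V → ℕ → ℝ
  W : V → ℕ → ℝ
  Pcond : V → V → ℕ → ℕ → ℝ
  Punary : V → ℕ → ℝ

attribute [instance] SPGM.fintypeV SPGM.decEqV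

namespace SPGM

variable {Xvar Zvar : Type} {Xdom : Xvar → ℕ} {Zdom : Zvar → ℕ}

def isVnode (S : SPGM Xvar Zvar Xdom Zdom) (t : S.V) : Prop :=
  ∃ x, S.kind t = SPGMKind.vnode x

def isProd (S : SPGM Xvar Zvar Xdom Zdom) (t : S.V) : Prop :=
  S.kind t = SPGMKind.prod

def isSumObs (S : SPGM Xvar Zvar Xdom Zdom) (t : S.V) : Prop :=
  ∃ z, S.kind t = SPGMKind.sumObs z

def isSumUnobs (S : SPGM Xvar Zvar Xdom Zdom) (t : S.V) : Prop :=
  S.kind t = SPGMKind.sumUnobs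

def isSum (S : SPGM Xvar Zvar Xdom Zdom) (t : S.V) : Prop :=
  S.isSumObs t ∨ S.isSumUnobs t

/-- The variable labeling a node, if any. -/
def label (S : SPGM Xvar Zvar Xdom Zdom) (t : S.V) : Option (Xvar ⊕ Zvar) :=
  match S.kind t with
  | SPGMKind.vnode x => some (Sum.inl x)
  | SPGMKind.sumObs z => some (Sum.inr z)
  | _ => none

/-- Domain size of the variable of a Vnode (`0` for non-Vnodes). -/
def domOf (S : SPGM Xvar Zvar Xdom Zdom) (t : S.V) : ℕ :=
  match S.kind t with
  | SPGMKind.vnode x => Xdom x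
  | _ => 0

/-- Reachability along directed edges. -/
def Reach (S : SPGM Xvar Zvar Xdom Zdom) : S.V → S.V → Prop :=
  Relation.ReflTransGen fun a b => b ∈ S.children a

/-- The scope of a node: all variables labeling nodes of the sub-DAG rooted at it. -/
def scope (S : SPGM Xvar Zvar Xdom Zdom) (t : S.V) : Set (Xvar ⊕ Zvar) :=
  {v | ∃ u, S.Reach t u ∧ S.label u = some v}

/-- There is a (nonempty) directed path from `s` to `t` containing no intermediate Vnode. -/
inductive ReachNoV (S : SPGM Xvar Zvar Xdom Zdom) : S.V → S.V → Prop where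
  | base {s c : S.V} : c ∈ S.children s → ReachNoV S s c
  | step {s t c : S.V} : ReachNoV S s t → ¬ S.isVnode t → c ∈ S.children t → ReachNoV S s c

/-- `s` is a Vparent of `t`. -/
def vparent (S : SPGM Xvar Zvar Xdom Zdom) (s t : S.V) : Prop :=
  S.isVnode s ∧ S.ReachNoV s t

/-- Validity of an SPGM: structural conditions and nonnegativity of all parameters. -/
structure Valid (S : SPGM Xvar Zvar Xdom Zdom) : Prop where
  xdom_pos : ∀ x : Xvar, 0 < Xdom x
  zdom_pos : ∀ z : Zvar, 0 < Zdom z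
  reach_root : ∀ v : S.V, S.Reach S.root v
  vnode_child : ∀ t : S.V, S.isVnode t → (S.children t).length ≤ 1
  vnode_scope : ∀ (t : S.V) (x : Xvar) (c : S.V), S.kind t = SPGMKind.vnode x →
    c ∈ S.children t → Sum.inl x ∉ S.scope c
  sum_child : ∀ t : S.V, S.isSum t → S.children t ≠ []
  sumObs_card : ∀ (t : S.V) (z : Zvar), S.kind t = SPGMKind.sumObs z →
    (S.children t).length = Zdom z
  sum_scope : ∀ t : S.V, S.isSum t →
    ∀ c ∈ S.children t, ∀ c' ∈ S.children t, S.scope c = S.scope c'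
  sumObs_scope : ∀ (t : S.V) (z : Zvar) (c : S.V), S.kind t = SPGMKind.sumObs z →
    c ∈ S.children t → Sum.inr z ∉ S.scope c
  prod_child : ∀ t : S.V, S.isProd t → S.children t ≠ []
  prod_scope : ∀ t : S.V, S.isProd t →
    (S.children t).Pairwise fun c c' => Disjoint (S.scope c) (S.scope c')
  Q_nonneg : ∀ (t : S.V) (k : ℕ), 0 ≤ S.Q t k
  W_nonneg : ∀ (t : S.V) (k : ℕ), 0 ≤ S.W t k
  Pcond_nonneg : ∀ (t s : S.V) (k j : ℕ), 0 ≤ S.Pcond t s k j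
  Punary_nonneg : ∀ (t : S.V) (k : ℕ), 0 ≤ S.Punary t k

/-- The conditional/unary tables of the SPGM are normalized probability tables. -/
structure Normalized (S : SPGM Xvar Zvar Xdom Zdom) : Prop where
  Pcond_sum : ∀ t s : S.V, S.isVnode t → S.vparent s t → ∀ j < S.domOf s,
    ∑ k ∈ Finset.range (S.domOf t), S.Pcond t s k j = 1
  Punary_sum : ∀ t : S.V, S.isVnode t → (¬ ∃ s, S.vparent s t) →
    ∑ k ∈ Finset.range (S.domOf t), S.Punary t k = 1

/-- Message passing, with explicit fuel (the fuel never runs out thanks to `rank_lt`):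
`msgAux S y n t s j` is the message `μ_{t→s;j}` (`s = none` denotes the fictitious root). -/
def msgAux (S : SPGM Xvar Zvar Xdom Zdom) (y : (Xvar ⊕ Zvar) → Option ℕ) :
    ℕ → S.V → Option S.V → ℕ → ℝ
  | 0, _, _, _ => 1
  | n + 1, t, s, j =>
    match S.kind t with
    | SPGMKind.vnode x =>
        ∑ k ∈ Finset.range (Xdom x),
          (match s with
            | some s' => S.Pcond t s' k j
            | none => S.Punary t k) *
            Indicator y (Sum.inl x) k *
            (match S.children t with
              | [] => (1 : ℝ)
              | c :: _ => msgAux S y n c (some t) k)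
    | SPGMKind.prod => ((S.children t).map fun c => msgAux S y n c s j).prod
    | SPGMKind.sumObs z =>
        ∑ k ∈ Finset.range (S.children t).length,
          Indicator y (Sum.inr z) k * S.Q t k * msgAux S y n ((S.children t).getD k t) s j
    | SPGMKind.sumUnobs =>
        ∑ k ∈ Finset.range (S.children t).length,
          S.W t k * msgAux S y n ((S.children t).getD k t) s j

/-- The message `μ_{t→s;j}` sent by node `t` under partial assignment `y`. -/
def msg (S : SPGM Xvar Zvar Xdom Zdom) (y : (Xvar ⊕ Zvar) → Option ℕ)
    (t : S.V) (s : Option S.V) (j : ℕ) : ℝ :=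
  msgAux S y (S.rank t + 1) t s j

/-- Evaluation of the SPGM at the partial assignment `y` (value of the root message). -/
def eval (S : SPGM Xvar Zvar Xdom Zdom) (y : (Xvar ⊕ Zvar) → Option ℕ) : ℝ :=
  S.msg y S.root none 0

end SPGM

/-- A (decomposable) sum-product network over variables `Var` with domain sizes `dom`:
indicator leaves, products, and weighted sums, with children indexed by `Fin n`. -/
inductive SPN (Var : Type) (dom : Var → ℕ) : Type where
  | leaf (v : Var) (i : ℕ) : SPN Var dom
  | prod (n : ℕ) (c : Fin n → SPN Var dom) : SPN Var dom
  | sum (n : ℕ) (w : Fin n → ℝ) (c : Fin n → SPN Var dom) : SPN Var dom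

namespace SPN

variable {Var : Type} {dom : Var → ℕ}

/-- The scope of an SPN. -/
def scope : SPN Var dom → Set Var
  | .leaf v _ => {v}
  | .prod _ c => ⋃ k, (c k).scope
  | .sum _ _ c => ⋃ k, (c k).scope

/-- Validity (decomposability): leaves use in-domain values, products have at least one
child and pairwise disjoint child scopes, sums have at least one child, nonnegative
weights and a common child scope. -/
def Valid : SPN Var dom → Prop
  | .leaf v i => i < dom v
  | .prod n c => 0 < n ∧ (∀ k, (c k).Valid) ∧
      ∀ k k', k ≠ k' → Disjoint ((c k).scope) ((c k').scope)
  | .sum n w c => 0 < n ∧ (∀ k, 0 ≤ w k) ∧ (∀ k, (c k).Valid) ∧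
      ∀ k k', (c k).scope = (c k').scope

/-- Evaluation of an SPN at a partial assignment `y`. -/
def eval (y : Var → Option ℕ) : SPN Var dom → ℝ
  | .leaf v i => Indicator y v i
  | .prod n c => ∏ k : Fin n, (c k).eval y
  | .sum n w c => ∑ k : Fin n, w k * (c k).eval y

end SPN

namespace SPN

variable {Var : Type} {dom : Var → ℕ}

/-- The list of immediate subnetworks. -/
def subnets : SPN Var dom → List (SPN Var dom)
  | .leaf _ _ => []
  | .prod _ c => List.ofFn c
  | .sum _ _ c => List.ofFn c

/-- The height of the expression tree. -/
def height : SPN Var dom → ℕ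
  | .leaf _ _ => 0
  | .prod _ c => (Finset.univ.sup fun k => (c k).height) + 1
  | .sum _ _ c => (Finset.univ.sup fun k => (c k).height) + 1

/-- The weight of the `k`-th edge at the root, zero unless the root is a sum. -/
def weight : SPN Var dom → ℕ → ℝ
  | .sum n w _, k => if h : k < n then w ⟨k, h⟩ else 0
  | _, _ => 0

/-- The unary table of a leaf, which selects its value. -/
def table : SPN Var dom → ℕ → ℝ
  | .leaf _ i, k => if k = i then 1 else 0
  | _, _ => 0

/-- The SPGM node kind of the root. -/
def kind : SPN Var dom → SPGMKind Var Empty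
  | .leaf v _ => .vnode v
  | .prod _ _ => .prod
  | .sum _ _ _ => .sumUnobs

/-- Occurrences of subnetworks, that is, nodes of the expression tree. -/
inductive Pos : SPN Var dom → Type where
  | top {N : SPN Var dom} : Pos N
  | prod {n : ℕ} {c : Fin n → SPN Var dom} (k : Fin n) (p : Pos (c k)) : Pos (.prod n c)
  | sum {n : ℕ} {w : Fin n → ℝ} {c : Fin n → SPN Var dom} (k : Fin n) (p : Pos (c k)) :
      Pos (.sum n w c)

/-- The subnetwork at an occurrence. -/
def Pos.subnet : (N : SPN Var dom) → N.Pos → SPN Var dom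
  | N, .top => N
  | .prod _ c, .prod k p => Pos.subnet (c k) p
  | .sum _ _ c, .sum k p => Pos.subnet (c k) p

/-- The children of an occurrence in the expression tree. -/
def Pos.children : (N : SPN Var dom) → N.Pos → List N.Pos
  | .leaf _ _, _ => []
  | .prod _ _, .top => List.ofFn fun k => .prod k .top
  | .prod _ c, .prod k p => (Pos.children (c k) p).map (.prod k)
  | .sum _ _ _, .top => List.ofFn fun k => .sum k .top
  | .sum _ _ c, .sum k p => (Pos.children (c k) p).map (.sum k)

instance finite_pos (N : SPN Var dom) : Finite N.Pos := by
  induction N with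
  | leaf v i =>
    refine Finite.of_surjective (fun _ : Unit => Pos.top) fun p => ?_
    cases p
    exact ⟨(), rfl⟩
  | prod n c ih =>
    refine Finite.of_surjective
      (fun o : Option (Σ k, (c k).Pos) => o.elim Pos.top fun q => .prod q.1 q.2) fun p => ?_
    cases p with
    | top => exact ⟨none, rfl⟩
    | prod k p => exact ⟨some ⟨k, p⟩, rfl⟩
  | sum n w c ih =>
    refine Finite.of_surjective
      (fun o : Option (Σ k, (c k).Pos) => o.elim Pos.top fun q => .sum q.1 q.2) fun p => ?_
    cases p with
    | top => exact ⟨none, rfl⟩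
    | sum k p => exact ⟨some ⟨k, p⟩, rfl⟩

theorem height_lt_of_mem_subnets {M N : SPN Var dom} (h : M ∈ N.subnets) :
    M.height < N.height := by
  cases N with
  | leaf v i => simp [subnets] at h
  | prod n c =>
    obtain ⟨k, rfl⟩ := (List.mem_ofFn' _ _).1 h
    exact Nat.lt_succ_of_le
      (Finset.le_sup (f := fun k => (c k).height) (Finset.mem_univ k))
  | sum n w c =>
    obtain ⟨k, rfl⟩ := (List.mem_ofFn' _ _).1 h
    exact Nat.lt_succ_of_le
      (Finset.le_sup (f := fun k => (c k).height) (Finset.mem_univ k))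

theorem Pos.subnet_top (N : SPN Var dom) : Pos.subnet N .top = N := by
  cases N <;> rfl

theorem Pos.map_subnet_children (N : SPN Var dom) (p : N.Pos) :
    (Pos.children N p).map (Pos.subnet N) = (Pos.subnet N p).subnets := by
  induction p with
  | @top N =>
    cases N <;>
      simp [Pos.children, Pos.subnet, subnets, List.map_ofFn, Function.comp_def]
  | prod k p ih => simpa [Pos.children, Pos.subnet, Function.comp_def] using ih
  | sum k p ih => simpa [Pos.children, Pos.subnet, Function.comp_def] using ih

theorem Pos.subnet_mem_subnets {N : SPN Var dom} {p q : N.Pos} (h : q ∈ Pos.children N p) :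
    Pos.subnet N q ∈ (Pos.subnet N p).subnets := by
  rw [← Pos.map_subnet_children]
  exact List.mem_map_of_mem h

theorem Pos.length_children (N : SPN Var dom) (p : N.Pos) :
    (Pos.children N p).length = (Pos.subnet N p).subnets.length := by
  rw [← Pos.map_subnet_children, List.length_map]

theorem Pos.subnet_getD_children (N : SPN Var dom) (p : N.Pos) (k : ℕ) :
    Pos.subnet N ((Pos.children N p).getD k p) =
      (Pos.subnet N p).subnets.getD k (Pos.subnet N p) := by
  rw [← Pos.map_subnet_children, List.getD_map]

theorem Pos.valid_subnet {N : SPN Var dom} (hN : N.Valid) (p : N.Pos) :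
    (Pos.subnet N p).Valid := by
  induction p with
  | top => rwa [Pos.subnet_top]
  | prod k p ih => exact ih (hN.2.1 k)
  | sum k p ih => exact ih (hN.2.2.1 k)

theorem Pos.reflTransGen_top (N : SPN Var dom) (p : N.Pos) :
    Relation.ReflTransGen (fun a b => b ∈ Pos.children N a) .top p := by
  induction p with
  | top => exact .refl
  | prod k p ih =>
    exact .head ((List.mem_ofFn' _ _).2 ⟨k, rfl⟩)
      (ih.lift (Pos.prod k) fun _ _ => List.mem_map_of_mem)
  | sum k p ih =>
    exact .head ((List.mem_ofFn' _ _).2 ⟨k, rfl⟩)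
      (ih.lift (Pos.sum k) fun _ _ => List.mem_map_of_mem)

/-- The SPGM whose graph is the expression tree of `N`. -/
abbrev toSPGM (N : SPN Var dom) : SPGM Var Empty dom (fun z => z.elim) where
  V := N.Pos
  fintypeV := Fintype.ofFinite _
  decEqV := Classical.decEq _
  root := .top
  kind p := (Pos.subnet N p).kind
  children := Pos.children N
  rank p := (Pos.subnet N p).height
  rank_lt _ _ h := height_lt_of_mem_subnets (Pos.subnet_mem_subnets h)
  Q _ _ := 0
  W p := (Pos.subnet N p).weight
  Pcond _ _ _ _ := 0
  Punary p := (Pos.subnet N p).table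

/-- The variable at the root, which is present only at leaves. -/
theorem scope_eq_label_union (M : SPN Var dom) :
    M.scope = {v | M.kind = .vnode v} ∪ ⋃ L ∈ M.subnets, L.scope := by
  cases M with
  | leaf v i => ext x; simp [scope, kind, subnets, eq_comm]
  | prod n c => ext x; simp [scope, kind, subnets, List.mem_ofFn']
  | sum n w c => ext x; simp [scope, kind, subnets, List.mem_ofFn']

theorem scope_toSPGM (N : SPN Var dom) (p : N.Pos) :
    N.toSPGM.scope p = Sum.inl '' (Pos.subnet N p).scope := by
  induction h : (Pos.subnet N p).height using Nat.strong_induction_on generalizing p with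
  | _ m ih =>
    subst h
    have ih' : ∀ q ∈ Pos.children N p,
        N.toSPGM.scope q = Sum.inl '' (Pos.subnet N q).scope := fun q hq =>
      ih _ (height_lt_of_mem_subnets (Pos.subnet_mem_subnets hq)) q rfl
    have label_iff : ∀ v : Var ⊕ Empty, N.toSPGM.label p = some v ↔
        ∃ x, (Pos.subnet N p).kind = .vnode x ∧ Sum.inl x = v := by
      intro v
      have hkind : N.toSPGM.kind p = (Pos.subnet N p).kind := rfl
      rw [SPGM.label, hkind]
      cases Pos.subnet N p <;> simp [kind]
    ext v
    rw [scope_eq_label_union, ← Pos.map_subnet_children]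
    constructor
    · rintro ⟨u, hu, hv⟩
      rcases hu.cases_head with rfl | ⟨q, hq, hqu⟩
      · obtain ⟨x, hx, rfl⟩ := (label_iff v).1 hv
        exact ⟨x, Or.inl hx, rfl⟩
      · have hmem : v ∈ N.toSPGM.scope q := ⟨u, hqu, hv⟩
        rw [ih' q hq] at hmem
        obtain ⟨x, hx, rfl⟩ := hmem
        exact ⟨x, Or.inr (Set.mem_biUnion (List.mem_map_of_mem hq) hx), rfl⟩
    · rintro ⟨x, hx | hx, rfl⟩
      · exact ⟨p, .refl, (label_iff _).2 ⟨x, hx, rfl⟩⟩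
      · simp only [Set.mem_iUnion, List.mem_map] at hx
        obtain ⟨_, ⟨q, hq, rfl⟩, hx⟩ := hx
        have hmem : Sum.inl x ∈ N.toSPGM.scope q := by
          rw [ih' q hq]
          exact ⟨x, hx, rfl⟩
        obtain ⟨u, hu, hv⟩ := hmem
        exact ⟨u, .head hq hu, hv⟩

theorem subnets_eq_nil_of_kind_eq_vnode {M : SPN Var dom} {x : Var}
    (h : M.kind = .vnode x) : M.subnets = [] := by
  cases M <;> simp_all [kind, subnets]

theorem Valid.subnets_ne_nil {M : SPN Var dom} (hM : M.Valid)
    (h : ∀ x, M.kind ≠ .vnode x) : M.subnets ≠ [] := by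
  cases M with
  | leaf v i => exact absurd rfl (h v)
  | prod n c => simpa [subnets] using hM.1.ne'
  | sum n w c => simpa [subnets] using hM.1.ne'

theorem Valid.scope_eq_of_mem_subnets {M L L' : SPN Var dom} (hM : M.Valid)
    (hk : M.kind = .sumUnobs) (hL : L ∈ M.subnets) (hL' : L' ∈ M.subnets) :
    L.scope = L'.scope := by
  cases M with
  | leaf v i => cases hk
  | prod n c => cases hk
  | sum n w c =>
    obtain ⟨k, rfl⟩ := (List.mem_ofFn' _ _).1 hL
    obtain ⟨k', rfl⟩ := (List.mem_ofFn' _ _).1 hL'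
    exact hM.2.2.2 k k'

theorem Valid.pairwise_subnets {M : SPN Var dom} (hM : M.Valid) (hk : M.kind = .prod) :
    M.subnets.Pairwise fun L L' => Disjoint L.scope L'.scope := by
  cases M with
  | leaf v i => cases hk
  | prod n c => exact List.pairwise_ofFn.2 fun i j hij => hM.2.2 i j hij.ne
  | sum n w c => cases hk

theorem Valid.weight_nonneg {M : SPN Var dom} (hM : M.Valid) (k : ℕ) : 0 ≤ M.weight k := by
  cases M with
  | leaf v i => exact le_rfl
  | prod n c => exact le_rfl
  | sum n w c =>
    simp only [weight]
    split_ifs with h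
    · exact hM.2.1 _
    · exact le_rfl

theorem table_nonneg (M : SPN Var dom) (k : ℕ) : 0 ≤ M.table k := by
  cases M with
  | leaf v i =>
    simp only [table]
    split_ifs <;> simp
  | prod n c => exact le_rfl
  | sum n w c => exact le_rfl

theorem Valid.toSPGM {N : SPN Var dom} (hdom : ∀ v, 0 < dom v) (hN : N.Valid) :
    N.toSPGM.Valid where
  xdom_pos := hdom
  zdom_pos z := z.elim
  reach_root := Pos.reflTransGen_top N
  vnode_child := by
    rintro t ⟨x, hx⟩
    refine (Pos.length_children N t).trans_le ?_
    simp [subnets_eq_nil_of_kind_eq_vnode hx]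
  vnode_scope t x c hx hc := by
    have hmem := Pos.subnet_mem_subnets hc
    simp [subnets_eq_nil_of_kind_eq_vnode hx] at hmem
  sum_child := by
    rintro t (⟨z, _⟩ | ht)
    · exact z.elim
    · have hne := (Pos.valid_subnet hN t).subnets_ne_nil fun x hx => by
        cases hx.symm.trans ht
      rw [← Pos.map_subnet_children N t] at hne
      exact fun h => hne (List.map_eq_nil_iff.2 h)
  sumObs_card _ z := z.elim
  sum_scope := by
    rintro t (⟨z, _⟩ | ht) c hc c' hc'
    · exact z.elim
    · rw [scope_toSPGM N c, scope_toSPGM N c',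
        (Pos.valid_subnet hN t).scope_eq_of_mem_subnets ht
          (Pos.subnet_mem_subnets hc) (Pos.subnet_mem_subnets hc')]
  sumObs_scope _ z := z.elim
  prod_child t ht := by
    have hne := (Pos.valid_subnet hN t).subnets_ne_nil fun x hx => by
      cases hx.symm.trans ht
    rw [← Pos.map_subnet_children N t] at hne
    exact fun h => hne (List.map_eq_nil_iff.2 h)
  prod_scope t ht := by
    have hpw := (Pos.valid_subnet hN t).pairwise_subnets ht
    rw [← Pos.map_subnet_children N t, List.pairwise_map] at hpw
    refine hpw.imp fun {c c'} h => ?_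
    rw [scope_toSPGM N c, scope_toSPGM N c']
    exact (Set.disjoint_image_iff Sum.inl_injective).2 h
  Q_nonneg _ _ := le_rfl
  W_nonneg t := (Pos.valid_subnet hN t).weight_nonneg
  Pcond_nonneg _ _ _ _ := le_rfl
  Punary_nonneg t := (Pos.subnet N t).table_nonneg

theorem msgAux_toSPGM {N : SPN Var dom} (hN : N.Valid) (y : Var ⊕ Empty → Option ℕ) (m : ℕ)
    (p : N.Pos) (hp : (Pos.subnet N p).height < m) :
    N.toSPGM.msgAux y m p none 0 = (Pos.subnet N p).eval fun v => y (Sum.inl v) := by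
  induction m generalizing p with
  | zero => exact absurd hp (Nat.not_lt_zero _)
  | succ m ih =>
    have ih' : ∀ q ∈ Pos.children N p, N.toSPGM.msgAux y m q none 0 =
        (Pos.subnet N q).eval fun v => y (Sum.inl v) := fun q hq =>
      ih q ((height_lt_of_mem_subnets (Pos.subnet_mem_subnets hq)).trans_le
        (Nat.lt_succ_iff.1 hp))
    have hsub := Pos.map_subnet_children N p
    have hlen := Pos.length_children N p
    have hget := Pos.subnet_getD_children N p
    have hval := Pos.valid_subnet hN p
    rw [SPGM.msgAux.eq_def]
    cases hM : Pos.subnet N p with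
    | leaf v i =>
      rw [hM] at hsub hval
      have hnil : Pos.children N p = [] := List.map_eq_nil_iff.1 hsub
      have hi : i < dom v := hval
      simp only [hM, kind, table, hnil, eval, mul_one, ite_mul, one_mul, zero_mul]
      rw [Finset.sum_ite_eq', if_pos (Finset.mem_range.2 hi)]
      rfl
    | prod n c =>
      rw [hM] at hsub
      simp only [hM, kind, eval]
      rw [List.map_congr_left ih', ← Function.comp_def (fun M : SPN Var dom => M.eval _),
        ← List.map_map, hsub, subnets, List.map_ofFn, List.prod_ofFn]
      rfl
    | sum n w c =>
      rw [hM] at hlen hget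
      simp only [subnets, List.length_ofFn] at hlen
      simp only [hM, kind, eval, weight]
      rw [hlen, Finset.sum_range]
      refine Finset.sum_congr rfl fun k _ => ?_
      have hk : (k : ℕ) < (Pos.children N p).length := hlen ▸ k.2
      rw [dif_pos k.2, ih' _ (by rw [List.getD_eq_getElem _ _ hk]; exact List.getElem_mem hk),
        hget]
      simp [subnets]

theorem eval_toSPGM {N : SPN Var dom} (hN : N.Valid) (y : Var ⊕ Empty → Option ℕ) :
    N.toSPGM.eval y = N.eval fun v => y (Sum.inl v) := by
  refine (msgAux_toSPGM hN y _ .top (Nat.lt_succ_self _)).trans ?_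
  rw [Pos.subnet_top]

end SPN

/-- For every decomposable SPN `N` over a finite set of variables with
finite nonempty domains there exists a valid SPGM `S` over the same variables (with no
context variables, and with the unary functions of leaf Vnodes allowed to be arbitrary
nonnegative functions such as indicators) whose evaluation by message passing equals the
SPN evaluation on every partial assignment.  Hence SPGMs are at least as expressive as
SPNs. -/
theorem spn_encoded_by_spgm {Var : Type} {dom : Var → ℕ} (hdom : ∀ v : Var, 0 < dom v)
    (N : SPN Var dom) (hN : N.Valid) :
    ∃ S : SPGM Var Empty dom (fun z => z.elim),
      S.Valid ∧
        ∀ y : Var → Option ℕ,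
          S.eval (fun v => match v with | Sum.inl a => y a | Sum.inr z => z.elim) =
            N.eval y := by
  exact ⟨N.toSPGM, hN.toSPGM hdom, fun y => SPN.eval_toSPGM hN _⟩
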